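/- Consider the parameterized aggregated iteration with Ω ⊆ ℝ^m compact, U ⊆ ℝⁿ nonempty convex and compact, ℓ : ℝⁿ × Ω → ℝ continuous such that for each ω ∈ Ω the function ℓ(·,ω) is convex, differentiable with L-Lipschitz gradient, and bounded below by M₀; symmetric positive definite matrices H_lb ⪯ H_ω ⪯ H_ub for each ω; D : ℝⁿ × Ω → ℝⁿ with closed graph on U × Ω and D(·,ω) nonexpansive with respect to ‖·‖_{H_ω} for each ω; Fix(T(·,ω)) ∩ U nonempty for each ω; α, μ ∈ (0,1) and s ∈ (0, λ_min(H_lb)/L). Define φ(ω) := inf{ℓ(u,ω) : u ∈ Fix(T(·,ω)) ∩ U} and φ_K(ω) := ℓ(u^K(ω),ω). If for each K there exists ω^K ∈ Ω with φ_K(ω^K) = inf_{ω∈Ω} φ_K(ω), then: (1) every limit point (ū, ω̄) of the sequence {(u^K(ω^K), ω^K)} satisfies φ(ω̄) = inf_{ω∈Ω} φ(ω) and T(ū, ω̄) = ū; and (2) inf_{ω∈Ω} φ_K(ω) → inf_{ω∈Ω} φ(ω) as K → ∞. -/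

import Mathlib

open scoped RealInnerProductSpace
open Filter Topology

/-- The `H`-inner product `⟨u, v⟩_H = uᵀ H v` on `ℝⁿ`. -/
noncomputable def hIP {n : ℕ} (H : Matrix (Fin n) (Fin n) ℝ)
    (u v : EuclideanSpace ℝ (Fin n)) : ℝ :=
  ⟪u, Matrix.toEuclideanLin H v⟫

/-- The `H`-norm `‖u‖_H = √(uᵀ H u)` on `ℝⁿ`. -/
noncomputable def hNorm {n : ℕ} (H : Matrix (Fin n) (Fin n) ℝ)
    (u : EuclideanSpace ℝ (Fin n)) : ℝ :=
  Real.sqrt (hIP H u u)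

/-- The smallest eigenvalue `λ_min(H)` of a Hermitian matrix `H`. -/
noncomputable def lambdaMin {n : ℕ} (H : Matrix (Fin n) (Fin n) ℝ)
    (hH : H.IsHermitian) : ℝ :=
  ⨅ i, hH.eigenvalues i


lemma aux_inv {n : ℕ} (H : Matrix (Fin n) (Fin n) ℝ) (hH : H.PosDef)
    (v : EuclideanSpace ℝ (Fin n)) :
    Matrix.toEuclideanLin H (Matrix.toEuclideanLin H⁻¹ v) = v := by
  have h : H * H⁻¹ = 1 := Matrix.mul_nonsing_inv H hH.det_pos.ne'.isUnit
  rw [← LinearMap.comp_apply]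
  have := Matrix.toLpLin_mul_same 2 H H⁻¹
  rw [← this, h]
  simp

lemma aux_factor {n : ℕ} (H : Matrix (Fin n) (Fin n) ℝ) (hH : H.PosDef) :
    ∃ B : EuclideanSpace ℝ (Fin n) →L[ℝ] EuclideanSpace ℝ (Fin n),
      ∀ x y, ⟪B x, B y⟫ = hIP H x y := by
  open scoped MatrixOrder in
  obtain ⟨X, hX, -, h⟩ :=
        sub_zero H ▸ CFC.exists_sqrt_of_isSelfAdjoint_of_quasispectrumRestricts hH.isHermitian
          (QuasispectrumRestricts.nnreal_of_nonneg hH.posSemidef.nonneg)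
  refine ⟨LinearMap.toContinuousLinearMap (Matrix.toEuclideanLin X), fun x y => ?_⟩
  have hX' : X.conjTranspose = X := hX
  have e : H = X.conjTranspose * X := by rw [hX']; simpa using h.symm
  rw [hIP, e, Matrix.toLpLin_mul_same, LinearMap.comp_apply,
    Matrix.toEuclideanLin_conjTranspose_eq_adjoint, LinearMap.adjoint_inner_right]
  rfl

lemma aux_lambda {n : ℕ} (H : Matrix (Fin n) (Fin n) ℝ) (hH : H.IsHermitian)
    (x : EuclideanSpace ℝ (Fin n)) : lambdaMin H hH * ‖x‖ ^ 2 ≤ hIP H x x := by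
  have hb : ∀ j, Matrix.toEuclideanLin H (hH.eigenvectorBasis j) =
      hH.eigenvalues j • hH.eigenvectorBasis j := by
    intro j
    have := hH.mulVec_eigenvectorBasis j
    rw [Matrix.toLpLin_apply, this]
    rfl
  have hsym := Matrix.isSymmetric_toEuclideanLin_iff.mpr hH
  have h1 : hIP H x x = ∑ j, hH.eigenvalues j * ⟪hH.eigenvectorBasis j, x⟫ ^ 2 := by
    rw [hIP, ← hH.eigenvectorBasis.sum_inner_mul_inner]
    refine Finset.sum_congr rfl fun j _ => ?_
    rw [← hsym, hb, real_inner_smul_left, real_inner_comm]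
    ring
  have h2 : ‖x‖ ^ 2 = ∑ j, ⟪hH.eigenvectorBasis j, x⟫ ^ 2 := by
    rw [← real_inner_self_eq_norm_sq, ← hH.eigenvectorBasis.sum_inner_mul_inner]
    refine Finset.sum_congr rfl fun j _ => ?_
    rw [real_inner_comm]
    ring
  rw [h1, h2, Finset.mul_sum]
  refine Finset.sum_le_sum fun j _ => ?_
  exact mul_le_mul_of_nonneg_right (ciInf_le (Set.finite_range _).bddBelow j) (sq_nonneg _)

section smooth
variable {F : Type*} [NormedAddCommGroup F] [InnerProductSpace ℝ F] [CompleteSpace F]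

lemma aux_line {f : F → ℝ} (hf : Differentiable ℝ f) (x v : F) (t : ℝ) :
    HasDerivAt (fun t : ℝ => f (x + t • v)) ⟪gradient f (x + t • v), v⟫ t := by
  have h1 := (hf (x + t • v)).hasGradientAt.hasFDerivAt
  have h2 : HasDerivAt (fun t : ℝ => x + t • v) v t := by
    simpa using ((hasDerivAt_id t).smul_const v).const_add x
  exact h1.comp_hasDerivAt t h2

lemma aux_descent {f : F → ℝ} (hf : Differentiable ℝ f) {L : ℝ} 
    (hLip : ∀ u v, ‖gradient f u - gradient f v‖ ≤ L * ‖u - v‖) (x v : F) :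
    f (x + v) ≤ f x + ⟪gradient f x, v⟫ + L / 2 * ‖v‖ ^ 2 := by
  let h : ℝ → ℝ := fun t => f (x + t • v) - t * ⟪gradient f x, v⟫ - L / 2 * ‖v‖ ^ 2 * t ^ 2
  have hd : ∀ t, HasDerivAt h (⟪gradient f (x + t • v), v⟫ - ⟪gradient f x, v⟫
      - L * ‖v‖ ^ 2 * t) t := by
    intro t
    have := ((aux_line hf x v t).sub ((hasDerivAt_id t).mul_const ⟪gradient f x, v⟫)).sub
      (((hasDerivAt_id t).pow 2).const_mul (L / 2 * ‖v‖ ^ 2))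
    refine this.congr_deriv ?_
    simp only [id]
    push_cast
    ring
  have hanti : AntitoneOn h (Set.Icc 0 1) := by
    refine antitoneOn_of_deriv_nonpos (convex_Icc _ _)
      (fun t _ => (hd t).continuousAt.continuousWithinAt)
      (fun t _ => (hd t).differentiableAt.differentiableWithinAt) ?_
    intro t ht
    rw [interior_Icc] at ht
    rw [(hd t).deriv, ← inner_sub_left]
    have h1 := real_inner_le_norm (gradient f (x + t • v) - gradient f x) v
    have h2 := hLip (x + t • v) x
    rw [add_sub_cancel_left, norm_smul, Real.norm_of_nonneg ht.1.le] at h2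
    have h3 := mul_le_mul_of_nonneg_right h2 (norm_nonneg v)
    nlinarith
  have := hanti (Set.left_mem_Icc.2 zero_le_one) (Set.right_mem_Icc.2 zero_le_one) zero_le_one
  simp only [h, one_smul, zero_smul, add_zero] at this
  linarith

lemma aux_convex {f : F → ℝ} (hf : Differentiable ℝ f) (hc : ConvexOn ℝ Set.univ f) (x y : F) :
    f x + ⟪gradient f x, y - x⟫ ≤ f y := by
  have hg : ConvexOn ℝ Set.univ (fun t : ℝ => f (x + t • (y - x))) := by
    have := hc.comp_affineMap (AffineMap.lineMap x y : ℝ →ᵃ[ℝ] F)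
    rw [Set.preimage_univ] at this
    refine this.congr fun t _ => ?_
    simp [AffineMap.lineMap_apply, add_comm]
  have := hg.le_slope_of_hasDerivAt (Set.mem_univ 0) (Set.mem_univ 1) zero_lt_one
    (aux_line hf x (y - x) 0)
  simp only [slope, zero_smul, add_zero, one_smul, sub_zero, inv_one, vsub_eq_sub, smul_eq_mul,
    one_mul, add_sub_cancel] at this
  linarith

lemma aux_gradbound {f : F → ℝ} (hf : Differentiable ℝ f) {L M : ℝ} (hL : 0 < L)
    (hLip : ∀ u v, ‖gradient f u - gradient f v‖ ≤ L * ‖u - v‖) (hb : ∀ x, M ≤ f x) (x : F) :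
    ‖gradient f x‖ ^ 2 ≤ 2 * L * (f x - M) := by
  have h1 := aux_descent hf hLip x (-(1 / L) • gradient f x)
  have h2 := hb (x + (-(1 / L) • gradient f x))
  rw [real_inner_smul_right, real_inner_self_eq_norm_sq, norm_smul, mul_pow] at h1
  have : ‖-(1 / L)‖ ^ 2 = (1 / L) ^ 2 := by simp
  rw [this] at h1
  have h3 : M ≤ f x - 1 / (2 * L) * ‖gradient f x‖ ^ 2 := by
    have e : -(1 / L) * ‖gradient f x‖ ^ 2 + L / 2 * ((1 / L) ^ 2 * ‖gradient f x‖ ^ 2) =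
      - (1 / (2 * L) * ‖gradient f x‖ ^ 2) := by field_simp; ring
    linarith
  have h4 : 1 / (2 * L) * ‖gradient f x‖ ^ 2 ≤ f x - M := by linarith
  rw [one_div, inv_mul_le_iff₀ (by positivity)] at h4
  exact h4

lemma aux_coco1 {f : F → ℝ} (hf : Differentiable ℝ f) (hc : ConvexOn ℝ Set.univ f)
    {L : ℝ} (hL : 0 < L)
    (hLip : ∀ u v, ‖gradient f u - gradient f v‖ ≤ L * ‖u - v‖) (x y : F) :
    ‖gradient f x - gradient f y‖ ^ 2 ≤
      2 * L * (f x - f y - ⟪gradient f y, x - y⟫) := by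
  set d := gradient f x - gradient f y with hd
  have h1 := aux_descent hf hLip x (-(1 / L) • d)
  have h2 := aux_convex hf hc y (x + (-(1 / L) • d))
  have e1 : x + (-(1 / L) • d) - y = (x - y) + (-(1 / L) • d) := by abel
  rw [e1, inner_add_right, real_inner_smul_right] at h2
  rw [real_inner_smul_right, norm_smul, mul_pow] at h1
  have : ‖-(1 / L)‖ ^ 2 = (1 / L) ^ 2 := by simp
  rw [this] at h1
  have e2 : ⟪gradient f x, d⟫ - ⟪gradient f y, d⟫ = ‖d‖ ^ 2 := by
    rw [← inner_sub_left, ← hd, real_inner_self_eq_norm_sq]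
  have e3 : ⟪gradient f x, d⟫ = ‖d‖ ^ 2 + ⟪gradient f y, d⟫ := by linarith
  rw [e3] at h1
  have e : -(1 / L) * ‖d‖ ^ 2 + L / 2 * ((1 / L) ^ 2 * ‖d‖ ^ 2) =
      - (1 / (2 * L) * ‖d‖ ^ 2) := by field_simp; ring
  have h4 : 1 / (2 * L) * ‖d‖ ^ 2 ≤ f x - f y - ⟪gradient f y, x - y⟫ := by linarith
  rw [one_div, inv_mul_le_iff₀ (by positivity)] at h4
  exact h4

lemma aux_coco {f : F → ℝ} (hf : Differentiable ℝ f) (hc : ConvexOn ℝ Set.univ f)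
    {L : ℝ} (hL : 0 < L)
    (hLip : ∀ u v, ‖gradient f u - gradient f v‖ ≤ L * ‖u - v‖) (x y : F) :
    ‖gradient f x - gradient f y‖ ^ 2 ≤ L * ⟪x - y, gradient f x - gradient f y⟫ := by
  have h1 := aux_coco1 hf hc hL hLip x y
  have h2 := aux_coco1 hf hc hL hLip y x
  rw [norm_sub_rev] at h2
  have e : ⟪x - y, gradient f x - gradient f y⟫ =
      - ⟪gradient f y, x - y⟫ - ⟪gradient f x, y - x⟫ := by
    simp only [inner_sub_right, inner_sub_left, real_inner_comm]
    ring
  rw [e]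
  nlinarith
end smooth


section iter
variable {F : Type*} [NormedAddCommGroup F] [InnerProductSpace ℝ F]

/-- Projection characterisation. -/
lemma aux_proj {V : Set F} (hV : Convex ℝ V) {q z : F} (hq : q ∈ V)
    (h : ∀ w ∈ V, ‖q - z‖ ≤ ‖w - z‖) : ∀ w ∈ V, ⟪z - q, w - q⟫ ≤ 0 := by
  refine (norm_eq_iInf_iff_real_inner_le_zero hV hq).1 ?_
  have : Nonempty V := ⟨⟨q, hq⟩⟩
  apply le_antisymm
  · refine le_ciInf fun w => ?_
    rw [norm_sub_rev z q, norm_sub_rev z w]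
    exact h w w.2
  · exact ciInf_le (f := fun w : V => ‖z - w‖) ⟨0, by rintro _ ⟨w, rfl⟩; exact norm_nonneg _⟩ ⟨q, hq⟩

lemma aux_proj_pyth {V : Set F} (hV : Convex ℝ V) {q z : F} (hq : q ∈ V)
    (h : ∀ w ∈ V, ‖q - z‖ ≤ ‖w - z‖) {p : F} (hp : p ∈ V) :
    ‖q - p‖ ^ 2 + ‖q - z‖ ^ 2 ≤ ‖z - p‖ ^ 2 := by
  have h1 := aux_proj hV hq h p hp
  have e : z - p = (z - q) - (p - q) := by abel
  rw [e, norm_sub_sq_real (z - q), norm_sub_rev q p, norm_sub_rev q z]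
  linarith

lemma aux_proj_nonexp {V : Set F} (hV : Convex ℝ V) {q z q' z' : F} (hq : q ∈ V)
    (h : ∀ w ∈ V, ‖q - z‖ ≤ ‖w - z‖) (hq' : q' ∈ V)
    (h' : ∀ w ∈ V, ‖q' - z'‖ ≤ ‖w - z'‖) : ‖q' - q‖ ≤ ‖z' - z‖ := by
  have h1 := aux_proj hV hq h q' hq'
  have h2 := aux_proj hV hq' h' q hq
  have h3 : ‖q' - q‖ ^ 2 ≤ ⟪z' - z, q' - q⟫ := by
    have e : ⟪z' - z, q' - q⟫ = ⟪q' - q, q' - q⟫ - ⟪z' - q', q - q'⟫ - ⟪z - q, q' - q⟫ := by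
      simp only [inner_sub_left, inner_sub_right]; ring
    rw [e, real_inner_self_eq_norm_sq]
    linarith
  have h4 := real_inner_le_norm (z' - z) (q' - q)
  by_contra hc
  push Not at hc
  have : 0 < ‖q' - q‖ := lt_of_le_of_lt (norm_nonneg _) hc
  nlinarith

/-- One step inequality, with the exact linear term. -/
lemma aux_step {θ t : ℝ} (hθ0 : 0 < θ) {x y g p : F} (hy : ‖y - p‖ ≤ ‖x - p‖) :
    ‖x + θ • (y - x) - t • g - p‖ ^ 2 + θ * (1 - θ) * ‖x - y‖ ^ 2 ≤
      ‖x - p‖ ^ 2 - 2 * t * ⟪g, x + θ • (y - x) - p⟫ + t ^ 2 * ‖g‖ ^ 2 := by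
  have e1 : x + θ • (y - x) - t • g - p = (x + θ • (y - x) - p) - t • g := by abel
  rw [e1, norm_sub_sq_real, real_inner_smul_right, norm_smul, mul_pow, Real.norm_eq_abs, sq_abs,
    real_inner_comm g]
  have e2 : x + θ • (y - x) - p = (x - p) + θ • ((y - p) - (x - p)) := by
    module
  have hh : ‖x + θ • (y - x) - p‖ ^ 2 + θ * (1 - θ) * ‖x - y‖ ^ 2 ≤ ‖x - p‖ ^ 2 := by
    have e3 : x - y = (x - p) - (y - p) := by abel
    have hy2 : ‖y - p‖ ^ 2 ≤ ‖x - p‖ ^ 2 := by gcongr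
    rw [e2, e3, norm_add_sq_real, norm_smul, mul_pow, Real.norm_eq_abs, sq_abs,
      real_inner_smul_right, inner_sub_right, real_inner_self_eq_norm_sq,
      norm_sub_sq_real (y - p) (x - p), norm_sub_sq_real (x - p) (y - p),
      real_inner_comm (x - p)]
    nlinarith
  linarith

lemma aux_S {θ : ℝ} (hθ0 : 0 < θ) (hθ1 : θ < 1) {x y p : F} (hy : ‖y - p‖ ≤ ‖x - p‖) :
    ‖x + θ • (y - x) - p‖ ≤ ‖x - p‖ := by
  have h := aux_step (t := 0) (g := 0) hθ0 hy
  simp only [zero_smul, sub_zero, mul_zero, zero_mul] at h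
  have h2 : 0 ≤ θ * (1 - θ) * ‖x - y‖ ^ 2 :=
    mul_nonneg (mul_nonneg hθ0.le (by linarith)) (sq_nonneg _)
  refine le_of_sq_le_sq ?_ (norm_nonneg _)
  norm_num at h
  linarith

/-- gradient step nonexpansive -/
lemma aux_gstep {Λ t : ℝ} (ht : 0 ≤ t) (htΛ : t * Λ ≤ 2) {a b : F}
    (h : ‖b‖ ^ 2 ≤ Λ * ⟪a, b⟫) (hΛ : 0 < Λ) : ‖a - t • b‖ ≤ ‖a‖ := by
  refine le_of_sq_le_sq ?_ (norm_nonneg _)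
  rw [norm_sub_sq_real, real_inner_smul_right, norm_smul, mul_pow, Real.norm_eq_abs, sq_abs]
  have h0 : 0 ≤ ⟪a, b⟫ := by
    by_contra hc
    push Not at hc
    nlinarith [sq_nonneg ‖b‖]
  have : t ^ 2 * ‖b‖ ^ 2 ≤ t * (t * Λ) * ⟪a, b⟫ := by nlinarith [sq_nonneg t]
  have h3 : t * (t * Λ) * ⟪a, b⟫ ≤ t * 2 * ⟪a, b⟫ := by gcongr
  linarith

set_option maxHeartbeats 1000000 in
lemma unif_rate {α μ s G R Λ : ℝ} (hα : α ∈ Set.Ioo (0 : ℝ) 1) (hμ : μ ∈ Set.Ioo (0 : ℝ) 1)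
    (hs : 0 < s) (hG : 0 ≤ G) (hR : 0 ≤ R) (hΛ : 0 < Λ) (hsΛ : s * Λ ≤ 2) :
    ∃ δ : ℕ → ℝ, Tendsto δ atTop (𝓝 0) ∧
      ∀ (V : Set F) (x y g : ℕ → F) (p : F), Convex ℝ V → p ∈ V → (∀ k, x k ∈ V) →
      (∀ k, ∀ w ∈ V, ‖x (k + 1) - (x k + ((1 - μ) * α) • (y k - x k)
          - (μ * (s / ((k : ℝ) + 1))) • g k)‖ ≤
        ‖w - (x k + ((1 - μ) * α) • (y k - x k) - (μ * (s / ((k : ℝ) + 1))) • g k)‖) →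
      (∀ j k, ‖y j - y k‖ ≤ ‖x j - x k‖) →
      (∀ k, ‖y k - p‖ ≤ ‖x k - p‖) →
      (∀ j k, ‖g j - g k‖ ^ 2 ≤ Λ * ⟪x j - x k, g j - g k⟫) →
      (∀ k, ‖g k‖ ≤ G) → (∀ k, ‖x k - p‖ ≤ R) →
      ∀ k, ‖x (k + 1) - x k‖ ≤ δ k ∧ ‖x k - y k‖ ≤ δ k := by
  obtain ⟨hα0, hα1⟩ := hα
  obtain ⟨hμ0, hμ1⟩ := hμ
  set θ := (1 - μ) * α with hθ
  have hθ0 : 0 < θ := mul_pos (by linarith) hα0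
  have hθ1 : θ < 1 := by nlinarith
  have hθ' : 0 < 1 - θ := by linarith
  have hθ2 : 0 < θ * (1 - θ) := mul_pos hθ0 hθ'
  set C := 2 * s * G * R + 2 * s ^ 2 * G ^ 2 with hC
  have hC0 : 0 ≤ C := by positivity
  set E := 6 / (1 - θ) * C + 2 * s ^ 2 * G ^ 2 with hE
  have hE0 : 0 ≤ E := by positivity
  set h : ℕ → ℝ := fun k => 1 / ((k : ℝ) + 1) with hh
  have hh0 : Tendsto h atTop (𝓝 0) := tendsto_one_div_add_atTop_nhds_zero_nat
  have hces : Tendsto (fun k : ℕ => ((k + 1 : ℕ) : ℝ)⁻¹ * ∑ i ∈ Finset.range (k + 1), h i)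
      atTop (𝓝 0) := (tendsto_add_atTop_iff_nat 1).2 hh0.cesaro
  set β : ℕ → ℝ := fun k => 6 / (1 - θ) * R ^ 2 * h k +
    E * (((k + 1 : ℕ) : ℝ)⁻¹ * ∑ i ∈ Finset.range (k + 1), h i) with hβ
  have hβ0 : Tendsto β atTop (𝓝 0) := by
    have := (hh0.const_mul (6 / (1 - θ) * R ^ 2)).add (hces.const_mul E)
    simpa only [mul_zero, add_zero] using this
  have hsβ0 : Tendsto (fun k => √(β k)) atTop (𝓝 0) := by
    have := (Real.continuous_sqrt.tendsto 0).comp hβ0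
    rwa [Real.sqrt_zero] at this
  set ρ : ℕ → ℝ := fun k => (θ * (1 - θ))⁻¹ * (2 * R * √(β k) + C * h k) with hρ
  have hρ0 : Tendsto ρ atTop (𝓝 0) := by
    have := ((hsβ0.const_mul (2 * R)).add (hh0.const_mul C)).const_mul (θ * (1 - θ))⁻¹
    simpa only [mul_zero, add_zero] using this
  have hsρ0 : Tendsto (fun k => √(ρ k)) atTop (𝓝 0) := by
    have := (Real.continuous_sqrt.tendsto 0).comp hρ0
    rwa [Real.sqrt_zero] at this
  refine ⟨fun k => √(β k) + √(ρ k), by simpa using hsβ0.add hsρ0, ?_⟩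
  intro V x y g p hV hp hx hproj hy hyp hg hgG hxR
  have hhpos : ∀ k, 0 < h k := fun k => by simp only [hh]; positivity
  have hh1 : ∀ k, h k ≤ 1 := fun k => by
    simp only [hh]
    rw [div_le_one (by positivity)]
    linarith [(Nat.cast_nonneg k : (0 : ℝ) ≤ k)]
  have hst : ∀ k : ℕ, s / ((k : ℝ) + 1) = s * h k := fun k => by simp only [hh]; ring
  simp only [hst] at hproj
  set z : ℕ → F := fun k => x k + θ • (y k - x k) - (μ * (s * h k)) • g k with hz
  have hpr : ∀ k, ∀ w ∈ V, ‖x (k + 1) - z k‖ ≤ ‖w - z k‖ := hproj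
  have hsk : ∀ k, 0 ≤ μ * (s * h k) := fun k => by have := hhpos k; positivity
  have hsk1 : ∀ k, μ * (s * h k) ≤ s * h k := fun k => by
    have : 0 ≤ s * h k := by have := hhpos k; positivity
    nlinarith
  have hsk2 : ∀ k, (μ * (s * h k)) ^ 2 * ‖g k‖ ^ 2 ≤ s ^ 2 * G ^ 2 * h k := fun k => by
    have h1 : (μ * (s * h k)) ^ 2 ≤ (s * h k) ^ 2 := pow_le_pow_left₀ (hsk k) (hsk1 k) 2
    have h2 : ‖g k‖ ^ 2 ≤ G ^ 2 := pow_le_pow_left₀ (norm_nonneg _) (hgG k) 2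
    have h3 : (s * h k) ^ 2 ≤ s ^ 2 * h k := by
      have := hhpos k
      have := hh1 k
      have : h k ^ 2 ≤ h k := by nlinarith
      rw [mul_pow]; gcongr
    calc _ ≤ (s ^ 2 * h k) * G ^ 2 := by
          apply mul_le_mul (h1.trans h3) h2 (sq_nonneg _)
          have := hhpos k; positivity
      _ = _ := by ring
  -- main energy inequality
  have hen : ∀ k, ‖x (k + 1) - p‖ ^ 2 + ‖x (k + 1) - z k‖ ^ 2 + θ * (1 - θ) * ‖x k - y k‖ ^ 2
      ≤ ‖x k - p‖ ^ 2 + (2 * s * G * R + s ^ 2 * G ^ 2) * h k := by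
    intro k
    have h1 := aux_proj_pyth hV (hx (k + 1)) (hpr k) hp
    have h2 := aux_step (t := μ * (s * h k)) (g := g k) hθ0 (hyp k)
    have h3 : -⟪g k, x k + θ • (y k - x k) - p⟫ ≤ G * R := by
      have a1 := neg_le_of_abs_le (abs_real_inner_le_norm (g k) (x k + θ • (y k - x k) - p))
      have a2 : ‖g k‖ * ‖x k + θ • (y k - x k) - p‖ ≤ G * R :=
        mul_le_mul (hgG k) ((aux_S hθ0 hθ1 (hyp k)).trans (hxR k)) (norm_nonneg _) hG
      linarith
    have h4 : (μ * (s * h k)) * -⟪g k, x k + θ • (y k - x k) - p⟫ ≤ (s * h k) * (G * R) := by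
      have a1 := mul_le_mul_of_nonneg_left h3 (hsk k)
      have a2 := mul_le_mul_of_nonneg_right (hsk1 k) (mul_nonneg hG hR)
      linarith
    have h5 := hsk2 k
    simp only [hz] at h1 ⊢
    linarith
  have hd2 : ∀ k, ‖x (k + 1) - x k‖ ^ 2 ≤
      3 / (1 - θ) * (‖x k - p‖ ^ 2 - ‖x (k + 1) - p‖ ^ 2 + C * h k) := by
    intro k
    have e : x (k + 1) - x k = (x (k + 1) - z k) + θ • (y k - x k) - (μ * (s * h k)) • g k := by
      simp only [hz]; abel
    have h1 : ‖x (k + 1) - x k‖ ≤ ‖x (k + 1) - z k‖ + θ * ‖x k - y k‖ + μ * (s * h k) * ‖g k‖ := by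
      rw [e]
      refine (norm_sub_le _ _).trans ?_
      refine (add_le_add_left (norm_add_le _ _) _).trans ?_
      rw [norm_smul, norm_smul, Real.norm_of_nonneg hθ0.le, Real.norm_of_nonneg (hsk k),
        norm_sub_rev (y k)]
    have h2 : ‖x (k + 1) - x k‖ ^ 2 ≤ 3 * (‖x (k + 1) - z k‖ ^ 2 + θ ^ 2 * ‖x k - y k‖ ^ 2
        + (μ * (s * h k)) ^ 2 * ‖g k‖ ^ 2) := by
      refine (pow_le_pow_left₀ (norm_nonneg _) h1 2).trans ?_
      nlinarith [sq_nonneg (‖x (k + 1) - z k‖ - θ * ‖x k - y k‖),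
        sq_nonneg (‖x (k + 1) - z k‖ - μ * (s * h k) * ‖g k‖),
        sq_nonneg (θ * ‖x k - y k‖ - μ * (s * h k) * ‖g k‖)]
    have h3 := hen k
    have h4 := hsk2 k
    rw [div_mul_eq_mul_div, le_div_iff₀ hθ']
    have h5 : (1 - θ) * ‖x (k + 1) - z k‖ ^ 2 ≤ ‖x (k + 1) - z k‖ ^ 2 := by
      nlinarith [sq_nonneg ‖x (k + 1) - z k‖]
    have h6 : (1 - θ) * (θ ^ 2 * ‖x k - y k‖ ^ 2) ≤ θ * (1 - θ) * ‖x k - y k‖ ^ 2 := by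
      have : 0 ≤ θ * (1 - θ) * ‖x k - y k‖ ^ 2 := by positivity
      have h0 := mul_le_of_le_one_left this hθ1.le
      linarith
    have h7 : (1 - θ) * ((μ * (s * h k)) ^ 2 * ‖g k‖ ^ 2) ≤ s ^ 2 * G ^ 2 * h k := by
      have : 0 ≤ (μ * (s * h k)) ^ 2 * ‖g k‖ ^ 2 := by positivity
      exact (mul_le_of_le_one_left this (by linarith)).trans h4
    have h8 := mul_le_mul_of_nonneg_right h2 hθ'.le
    simp only [hC]
    linarith
  set b : ℕ → ℝ := fun k => ‖x (k + 1) - x k‖ + s * G * h k with hb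
  have hbanti : Antitone b := by
    refine antitone_nat_of_succ_le fun k => ?_
    simp only [hb]
    have h1 := aux_proj_nonexp hV (hx (k + 1)) (hpr k) (hx (k + 1 + 1)) (hpr (k + 1))
    have hle : h (k + 1) ≤ h k := by
      simp only [hh]; push_cast
      apply one_div_le_one_div_of_le (by positivity); linarith
    have e : z (k + 1) - z k =
        μ • ((x (k + 1) - x k) - (s * h (k + 1)) • (g (k + 1) - g k))
        + (1 - μ) • ((1 - α) • (x (k + 1) - x k) + α • (y (k + 1) - y k))
        + (μ * (s * (h k - h (k + 1)))) • g k := by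
      simp only [hz, hθ]
      module
    have h2 : ‖(x (k + 1) - x k) - (s * h (k + 1)) • (g (k + 1) - g k)‖ ≤ ‖x (k + 1) - x k‖ := by
      apply aux_gstep _ _ (hg _ _) hΛ
      · have := hhpos (k + 1); positivity
      · have := hh1 (k + 1)
        have : 0 ≤ s * Λ := by positivity
        nlinarith [hhpos (k + 1)]
    have h3 : ‖(1 - α) • (x (k + 1) - x k) + α • (y (k + 1) - y k)‖ ≤ ‖x (k + 1) - x k‖ := by
      refine (norm_add_le _ _).trans ?_
      rw [norm_smul, norm_smul, Real.norm_of_nonneg hα0.le, Real.norm_of_nonneg (by linarith)]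
      nlinarith [hy (k + 1) k]
    have h4 : ‖z (k + 1) - z k‖ ≤ ‖x (k + 1) - x k‖ + s * G * (h k - h (k + 1)) := by
      rw [e]
      have hnn : 0 ≤ s * (h k - h (k + 1)) := mul_nonneg hs.le (by linarith)
      refine (norm_add_le _ _).trans ?_
      refine (add_le_add_left (norm_add_le _ _) _).trans ?_
      rw [norm_smul, norm_smul, norm_smul, Real.norm_of_nonneg hμ0.le,
        Real.norm_of_nonneg (show 0 ≤ 1 - μ by linarith), Real.norm_of_nonneg (mul_nonneg hμ0.le hnn)]
      have a1 := mul_le_mul_of_nonneg_left h2 hμ0.le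
      have a2 := mul_le_mul_of_nonneg_left h3 (show 0 ≤ 1 - μ by linarith)
      have a3 : μ * (s * (h k - h (k + 1))) * ‖g k‖ ≤ s * (h k - h (k + 1)) * G := by
        apply mul_le_mul _ (hgG k) (norm_nonneg _) hnn
        nlinarith
      linarith
    linarith
  have hbnn : ∀ k, 0 ≤ b k := fun k => by
    have := hhpos k
    simp only [hb]; positivity
  have hbβ : ∀ K, b K ^ 2 ≤ β K := by
    intro K
    have hk : ∀ k ∈ Finset.range (K + 1), b K ^ 2 ≤
        6 / (1 - θ) * (‖x k - p‖ ^ 2 - ‖x (k + 1) - p‖ ^ 2) + E * h k := by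
      intro k hk
      have h1 : b K ≤ b k := hbanti (by simpa [Nat.lt_succ_iff] using hk)
      have h2 : b K ^ 2 ≤ b k ^ 2 := pow_le_pow_left₀ (hbnn K) h1 2
      have h3 : b k ^ 2 ≤ 2 * ‖x (k + 1) - x k‖ ^ 2 + 2 * (s * G * h k) ^ 2 := by
        simp only [hb]
        nlinarith [sq_nonneg (‖x (k + 1) - x k‖ - s * G * h k)]
      have h4 : (s * G * h k) ^ 2 ≤ s ^ 2 * G ^ 2 * h k := by
        have := hhpos k
        have := hh1 k
        have : h k ^ 2 ≤ h k := by nlinarith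
        rw [mul_pow, mul_pow]; gcongr
      have h5 := hd2 k
      have e : 6 / (1 - θ) = 2 * (3 / (1 - θ)) := by ring
      simp only [hE]
      rw [e]
      linarith
    have hsum := Finset.sum_le_sum hk
    rw [Finset.sum_const, Finset.card_range, nsmul_eq_mul, Finset.sum_add_distrib,
      ← Finset.mul_sum, ← Finset.mul_sum, Finset.sum_range_sub' (fun k => ‖x k - p‖ ^ 2)] at hsum
    have h1 : ‖x 0 - p‖ ^ 2 - ‖x (K + 1) - p‖ ^ 2 ≤ R ^ 2 := by
      have := pow_le_pow_left₀ (norm_nonneg _) (hxR 0) 2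
      linarith [sq_nonneg ‖x (K + 1) - p‖]
    have h2 : 6 / (1 - θ) * (‖x 0 - p‖ ^ 2 - ‖x (K + 1) - p‖ ^ 2) ≤ 6 / (1 - θ) * R ^ 2 :=
      mul_le_mul_of_nonneg_left h1 (by positivity)
    have hpos : (0 : ℝ) < ((K + 1 : ℕ) : ℝ) := by positivity
    have h3 : b K ^ 2 ≤ ((K + 1 : ℕ) : ℝ)⁻¹ *
        (6 / (1 - θ) * R ^ 2 + E * ∑ i ∈ Finset.range (K + 1), h i) := by
      rw [le_inv_mul_iff₀ hpos]
      linarith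
    refine h3.trans (le_of_eq ?_)
    simp only [hβ, hh]
    push_cast
    ring
  have hdβ : ∀ k, ‖x (k + 1) - x k‖ ≤ √(β k) := by
    intro k
    refine le_trans ?_ (Real.le_sqrt_of_sq_le (hbβ k))
    simp only [hb]
    have := hhpos k
    have : 0 ≤ s * G * h k := by positivity
    linarith
  intro k
  refine ⟨(hdβ k).trans (le_add_of_nonneg_right (Real.sqrt_nonneg _)), ?_⟩
  refine le_trans (Real.le_sqrt_of_sq_le ?_) (le_add_of_nonneg_left (Real.sqrt_nonneg _))
  simp only [hρ]
  rw [le_inv_mul_iff₀ hθ2]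
  have h1 := hen k
  have h2 : ‖x k - p‖ - ‖x (k + 1) - p‖ ≤ ‖x (k + 1) - x k‖ := by
    have := norm_sub_norm_le (x k - p) (x (k + 1) - p)
    rwa [sub_sub_sub_cancel_right, norm_sub_rev (x k) (x (k + 1))] at this
  have h3 : ‖x k - p‖ ^ 2 - ‖x (k + 1) - p‖ ^ 2 ≤ 2 * R * √(β k) := by
    have a1 := h2.trans (hdβ k)
    have a2 : ‖x k - p‖ ^ 2 - ‖x (k + 1) - p‖ ^ 2 =
      (‖x k - p‖ + ‖x (k + 1) - p‖) * (‖x k - p‖ - ‖x (k + 1) - p‖) := by ring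
    rw [a2]
    calc _ ≤ (‖x k - p‖ + ‖x (k + 1) - p‖) * √(β k) := by gcongr
      _ ≤ (2 * R) * √(β k) := by
        gcongr
        linarith [hxR k, hxR (k + 1)]
  have h4 : 0 ≤ s ^ 2 * G ^ 2 * h k := by have := hhpos k; positivity
  simp only [hC]
  nlinarith [sq_nonneg ‖x (k + 1) - z k‖]

end iter


section pointwise

lemma aux_real {W a t η d : ℕ → ℝ} {c : ℝ} (hW : ∀ k, 0 ≤ W k) (ht : ∀ k, 0 ≤ t k)
    (hdiv : Tendsto (fun n => ∑ k ∈ Finset.range n, t k) atTop atTop)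
    (hη : Tendsto η atTop (𝓝 0)) (hd : Tendsto d atTop (𝓝 0))
    (h1 : ∀ k, W (k + 1) ^ 2 ≤ W k ^ 2 - t k * (2 * (a k - c) - η k))
    (h2 : ∀ k, W (k + 1) ≤ W k + d k)
    (h3 : ∀ δ > 0, ∃ ε > 0, ∀ᶠ k in atTop, a k ≤ c + ε → W k ≤ δ) :
    Tendsto W atTop (𝓝 0) := by
  have key : ∀ δ > 0, ∀ᶠ k in atTop, W k ≤ 2 * δ := by
    intro δ hδ
    obtain ⟨ε, hε, hev⟩ := h3 δ hδ
    have hηε : ∀ᶠ k in atTop, η k ≤ ε := hη.eventually_le_const hε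
    have hdδ : ∀ᶠ k in atTop, d k ≤ δ := hd.eventually_le_const hδ
    obtain ⟨N, hN⟩ := eventually_atTop.1 (hev.and (hηε.and hdδ))
    have hdec : ∀ k ≥ N, δ < W k → W (k + 1) ^ 2 ≤ W k ^ 2 - t k * ε := by
      intro k hk hlt
      obtain ⟨b1, b2, b3⟩ := hN k hk
      have : c + ε < a k := by
        by_contra hc
        exact absurd (b1 (not_lt.1 hc)) (not_le.2 hlt)
      refine (h1 k).trans ?_
      have := mul_le_mul_of_nonneg_left (show ε ≤ 2 * (a k - c) - η k by linarith) (ht k)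
      linarith
    have hex : ∃ k₀ ≥ N, W k₀ ≤ δ := by
      by_contra hc
      push Not at hc
      have hsum : ∀ j, W (N + j) ^ 2 ≤ W N ^ 2 -
          ε * (∑ k ∈ Finset.range (N + j), t k - ∑ k ∈ Finset.range N, t k) := by
        intro j
        induction j with
        | zero => simp
        | succ j ih =>
          have := hdec (N + j) (by omega) (hc _ (by omega))
          rw [← add_assoc, Finset.sum_range_succ]
          linarith
      have htt := hdiv.comp (tendsto_add_atTop_nat N)
      obtain ⟨j, hj⟩ := (htt.eventually_gt_atTop
        (∑ k ∈ Finset.range N, t k + W N ^ 2 / ε)).exists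
      simp only [Function.comp] at hj
      have h5 := hsum j
      rw [add_comm N j] at h5
      have h6 : ε * (W N ^ 2 / ε) = W N ^ 2 := by field_simp
      nlinarith [sq_nonneg (W (j + N))]
    obtain ⟨k₀, hk₀, hWk₀⟩ := hex
    refine eventually_atTop.2 ⟨k₀, fun k hk => ?_⟩
    induction k, hk using Nat.le_induction with
    | base => linarith
    | succ k hk ih =>
      obtain ⟨b1, b2, b3⟩ := hN k (hk₀.trans hk)
      by_cases hle : W k ≤ δ
      · linarith [h2 k]
      · have h4 := hdec k (hk₀.trans hk) (not_le.1 hle)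
        have h5 : W (k + 1) ^ 2 ≤ W k ^ 2 := by nlinarith [ht k]
        exact (le_of_sq_le_sq h5 (hW k)).trans ih
  rw [Metric.tendsto_atTop']
  intro ε hε
  obtain ⟨N, hN⟩ := eventually_atTop.1 (key (ε / 4) (by linarith))
  refine ⟨N, fun k hk => ?_⟩
  rw [Real.dist_eq, sub_zero, abs_of_nonneg (hW k)]
  linarith [hN k hk.le]

lemma pointwise {E F : Type*} [NormedAddCommGroup E] [NormedSpace ℝ E]
    [NormedAddCommGroup F] [NormedSpace ℝ F]
    (B : E →L[ℝ] F) (hB : Function.Injective B) {U X : Set E} (hU : IsCompact U)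
    {f : E → ℝ} (hf : Continuous f) (hXU : X ⊆ U) (hXc : IsClosed X) (hXne : X.Nonempty)
    {u : ℕ → E} (huU : ∀ k, u k ∈ U)
    (hlim : ∀ ψ : ℕ → ℕ, StrictMono ψ → ∀ ub, Tendsto (fun j => u (ψ j)) atTop (𝓝 ub) → ub ∈ X)
    {t η d : ℕ → ℝ} (ht : ∀ k, 0 ≤ t k)
    (hdiv : Tendsto (fun n => ∑ k ∈ Finset.range n, t k) atTop atTop)
    (hη : Tendsto η atTop (𝓝 0)) (hd : Tendsto d atTop (𝓝 0))
    (h1 : ∀ p ∈ X, ∀ k, ‖B (u (k + 1)) - B p‖ ^ 2 ≤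
      ‖B (u k) - B p‖ ^ 2 - t k * (2 * (f (u k) - f p) - η k))
    (h2 : ∀ k, ‖B (u (k + 1)) - B (u k)‖ ≤ d k) :
    Tendsto (fun k => f (u k)) atTop (𝓝 (sInf (f '' X))) := by
  have hXcp : IsCompact X := hU.of_isClosed_subset hXc hXU
  obtain ⟨p₀, hp₀, hmin⟩ := hXcp.exists_isMinOn hXne hf.continuousOn
  have hmin' : ∀ p ∈ X, f p₀ ≤ f p := fun p hp => hmin hp
  have hc : sInf (f '' X) = f p₀ := by
    refine IsLeast.csInf_eq ⟨⟨p₀, hp₀, rfl⟩, ?_⟩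
    rintro _ ⟨p, hp, rfl⟩
    exact hmin' p hp
  rw [hc]
  set c := f p₀ with hcdef
  set X' : Set E := X ∩ {p | f p ≤ c} with hX'
  have hX'cp : IsCompact X' := hXcp.inter_right (isClosed_le hf continuous_const)
  have hX'ne : X'.Nonempty := ⟨p₀, hp₀, le_refl (f p₀)⟩
  set Y := B '' X' with hY
  have hYcp : IsCompact Y := hX'cp.image B.continuous
  have hYne : Y.Nonempty := hX'ne.image _
  set W : ℕ → ℝ := fun k => Metric.infDist (B (u k)) Y with hWdef
  have hcont : Continuous fun x => Metric.infDist (B x) Y :=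
    (Metric.continuous_infDist_pt Y).comp B.continuous
  have hWlim : Tendsto W atTop (𝓝 0) := by
    refine aux_real (a := fun k => f (u k)) (c := c) (fun k => Metric.infDist_nonneg) ht hdiv hη hd
      ?_ ?_ ?_
    · intro k
      obtain ⟨q, ⟨p, hp, rfl⟩, hq⟩ := hYcp.exists_infDist_eq_dist hYne (B (u k))
      have hfp : f p = c := le_antisymm hp.2 (hmin' p hp.1)
      have h3 := h1 p hp.1 k
      rw [hfp] at h3
      have h4 : W (k + 1) ≤ ‖B (u (k + 1)) - B p‖ := by
        rw [← dist_eq_norm]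
        exact Metric.infDist_le_dist_of_mem ⟨p, hp, rfl⟩
      have h5 : W k = ‖B (u k) - B p‖ := by rw [← dist_eq_norm]; exact hq
      rw [h5]
      exact (pow_le_pow_left₀ Metric.infDist_nonneg h4 2).trans h3
    · intro k
      have := Metric.infDist_le_infDist_add_dist (s := Y) (x := B (u (k + 1))) (y := B (u k))
      rw [dist_eq_norm] at this
      exact this.trans (add_le_add_right (h2 k) _)
    · intro δ hδ
      by_contra hcon
      push Not at hcon
      have hfreq : ∀ j : ℕ, ∃ᶠ k in atTop, f (u k) ≤ c + 1 / ((j : ℝ) + 1) ∧ δ < W k :=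
        fun j => hcon _ (by positivity)
      obtain ⟨ψ, hψ, hψ'⟩ := extraction_forall_of_frequently hfreq
      obtain ⟨ub, -, χ, hχ, hlimχ⟩ := hU.tendsto_subseq (fun j => huU (ψ j))
      have hub : ub ∈ X := hlim (ψ ∘ χ) (hψ.comp hχ) ub hlimχ
      have hfl : Tendsto (fun j => f (u (ψ (χ j)))) atTop (𝓝 (f ub)) :=
        (hf.tendsto ub).comp hlimχ
      have hle : f ub ≤ c := by
        have hr : Tendsto (fun j => c + 1 / (((χ j : ℕ) : ℝ) + 1)) atTop (𝓝 c) := by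
          have := ((tendsto_one_div_add_atTop_nhds_zero_nat (𝕜 := ℝ)).comp
            hχ.tendsto_atTop).const_add c
          rw [add_zero] at this
          exact this
        exact le_of_tendsto_of_tendsto' hfl hr fun j => (hψ' (χ j)).1
      have hWl : Tendsto (fun j => W (ψ (χ j))) atTop (𝓝 (Metric.infDist (B ub) Y)) :=
        (hcont.tendsto ub).comp hlimχ
      have h0 : Metric.infDist (B ub) Y = 0 :=
        Metric.infDist_zero_of_mem ⟨ub, ⟨hub, hle⟩, rfl⟩
      rw [h0] at hWl
      exact absurd (ge_of_tendsto' hWl fun j => (hψ' (χ j)).2.le) (not_le.2 hδ)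
  refine tendsto_of_subseq_tendsto fun ns hns => ?_
  obtain ⟨ub, -, χ, hχ, hlimχ⟩ := hU.tendsto_subseq (fun j => huU (ns j))
  refine ⟨χ, ?_⟩
  have hWl : Tendsto (fun j => W (ns (χ j))) atTop (𝓝 (Metric.infDist (B ub) Y)) :=
    (hcont.tendsto ub).comp hlimχ
  have h0 : Metric.infDist (B ub) Y = 0 :=
    tendsto_nhds_unique hWl (hWlim.comp (hns.comp hχ.tendsto_atTop))
  have hmem : B ub ∈ Y := (hYcp.isClosed.mem_iff_infDist_zero hYne).2 h0
  obtain ⟨p, hp, hpe⟩ := hmem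
  have : p = ub := hB hpe
  subst this
  have hfp : f p = c := le_antisymm hp.2 (hmin' p hp.1)
  rw [← hfp]
  exact (hf.tendsto p).comp hlimχ

end pointwise

/-- approximation quality of the parameterized aggregated
iteration (Theorem 2 of the paper): if `ω^K` minimizes `φ_K(ω) = ℓ(u^K(ω),ω)`
over `Ω`, then every limit point of `(u^K(ω^K), ω^K)` solves the bilevel
problem, and `inf_Ω φ_K → inf_Ω φ`. -/
theorem stmt_13 {n m : ℕ}
    (Ω : Set (EuclideanSpace ℝ (Fin m))) (hΩcp : IsCompact Ω)
    (U : Set (EuclideanSpace ℝ (Fin n)))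
    (hUne : U.Nonempty) (hUco : Convex ℝ U) (hUcp : IsCompact U)
    (ℓ : EuclideanSpace ℝ (Fin n) → EuclideanSpace ℝ (Fin m) → ℝ)
    (hℓc : Continuous fun p : EuclideanSpace ℝ (Fin n) × EuclideanSpace ℝ (Fin m) =>
      ℓ p.1 p.2)
    (L M₀ : ℝ) (hL : 0 < L)
    (hconv : ∀ ω ∈ Ω, ConvexOn ℝ Set.univ fun x => ℓ x ω)
    (hdiff : ∀ ω ∈ Ω, Differentiable ℝ fun x => ℓ x ω)
    (hLip : ∀ ω ∈ Ω, ∀ u v,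
      ‖gradient (fun x => ℓ x ω) u - gradient (fun x => ℓ x ω) v‖ ≤ L * ‖u - v‖)
    (hbdd : ∀ ω ∈ Ω, ∀ x, M₀ ≤ ℓ x ω)
    (Hlb Hub : Matrix (Fin n) (Fin n) ℝ) (hlb : Hlb.PosDef) (hub : Hub.PosDef)
    (HM : EuclideanSpace ℝ (Fin m) → Matrix (Fin n) (Fin n) ℝ)
    (hHM : ∀ ω ∈ Ω, (HM ω).PosDef)
    (hHMlb : ∀ ω ∈ Ω, ∀ x, hIP Hlb x x ≤ hIP (HM ω) x x)
    (hHMub : ∀ ω ∈ Ω, ∀ x, hIP (HM ω) x x ≤ hIP Hub x x)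
    (D : EuclideanSpace ℝ (Fin n) → EuclideanSpace ℝ (Fin m) → EuclideanSpace ℝ (Fin n))
    (hD : ∀ ω ∈ Ω, ∀ u₁ u₂,
      hNorm (HM ω) (D u₁ ω - D u₂ ω) ≤ hNorm (HM ω) (u₁ - u₂))
    (hDgraph : ∀ (x : ℕ → EuclideanSpace ℝ (Fin n)) (w : ℕ → EuclideanSpace ℝ (Fin m))
      (x₀ : EuclideanSpace ℝ (Fin n)) (w₀ : EuclideanSpace ℝ (Fin m))
      (v : EuclideanSpace ℝ (Fin n)),
      (∀ j, x j ∈ U) → (∀ j, w j ∈ Ω) →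
      Tendsto x atTop (𝓝 x₀) → Tendsto w atTop (𝓝 w₀) →
      Tendsto (fun j => D (x j) (w j)) atTop (𝓝 v) → v = D x₀ w₀)
    (α μ : ℝ) (hα : α ∈ Set.Ioo (0 : ℝ) 1) (hμ : μ ∈ Set.Ioo (0 : ℝ) 1)
    (s : ℝ) (hs : s ∈ Set.Ioo 0 (lambdaMin Hlb hlb.1 / L))
    (T : EuclideanSpace ℝ (Fin n) → EuclideanSpace ℝ (Fin m) → EuclideanSpace ℝ (Fin n))
    (hT : ∀ x ω, T x ω = (1 - α) • x + α • D x ω)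
    (hFix : ∀ ω ∈ Ω, ({x | T x ω = x} ∩ U).Nonempty)
    (φ : EuclideanSpace ℝ (Fin m) → ℝ)
    (hφ : ∀ ω, φ ω = sInf ((fun x => ℓ x ω) '' ({x | T x ω = x} ∩ U)))
    (u vl vu : ℕ → EuclideanSpace ℝ (Fin m) → EuclideanSpace ℝ (Fin n))
    (hu0 : ∀ ω ∈ Ω, u 0 ω ∈ U)
    (hvl : ∀ ω ∈ Ω, ∀ k, vl (k + 1) ω = T (u k ω) ω)
    (hvu : ∀ ω ∈ Ω, ∀ k, vu (k + 1) ω =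
      u k ω - (s / ((k : ℝ) + 1)) •
        Matrix.toEuclideanLin (HM ω)⁻¹ (gradient (fun x => ℓ x ω) (u k ω)))
    (hproj : ∀ ω ∈ Ω, ∀ k, u (k + 1) ω ∈ U ∧ ∀ w ∈ U,
      hNorm (HM ω) (u (k + 1) ω - (μ • vu (k + 1) ω + (1 - μ) • vl (k + 1) ω)) ≤
        hNorm (HM ω) (w - (μ • vu (k + 1) ω + (1 - μ) • vl (k + 1) ω)))
    (ωK : ℕ → EuclideanSpace ℝ (Fin m))
    (hωKΩ : ∀ K, ωK K ∈ Ω)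
    (hωKmin : ∀ K, ∀ ω ∈ Ω, ℓ (u K (ωK K)) (ωK K) ≤ ℓ (u K ω) ω) :
    (∀ (ub : EuclideanSpace ℝ (Fin n)) (ωb : EuclideanSpace ℝ (Fin m)),
      (∃ ψ : ℕ → ℕ, StrictMono ψ ∧
        Tendsto (fun j => (u (ψ j) (ωK (ψ j)), ωK (ψ j))) atTop (𝓝 (ub, ωb))) →
      φ ωb = sInf (φ '' Ω) ∧ T ub ωb = ub) ∧
    Tendsto (fun K => sInf ((fun ω => ℓ (u K ω) ω) '' Ω)) atTop
      (𝓝 (sInf (φ '' Ω))) := by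
  have hμ' := hμ
  have hα' := hα
  obtain ⟨hα0, hα1⟩ := hα'
  obtain ⟨hμ0, hμ1⟩ := hμ'
  obtain ⟨hs0, hs1⟩ := hs
  set lam := lambdaMin Hlb hlb.1 with hlam
  have hlam0 : 0 < lam := by
    have := hs0.trans hs1
    have := mul_pos this hL
    rwa [div_mul_cancel₀ _ hL.ne'] at this
  have hΛ : 0 < L / lam := by positivity
  have hsΛ : s * (L / lam) ≤ 2 := by
    rw [lt_div_iff₀ hL] at hs1
    rw [← mul_div_assoc, div_le_iff₀ hlam0]
    linarith
  have hfix : ∀ x ω, T x ω = x ↔ D x ω = x := by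
    intro x ω
    rw [hT]
    constructor
    · intro h
      have h2 : α • (D x ω - x) = 0 := by
        have : (1 - α) • x + α • D x ω - x = 0 := sub_eq_zero.2 h
        rw [← this]; module
      exact sub_eq_zero.1 ((smul_eq_zero.1 h2).resolve_left hα0.ne')
    · intro h
      rw [h]; module
  have huU : ∀ ω ∈ Ω, ∀ k, u k ω ∈ U := by
    intro ω hω k
    cases k with
    | zero => exact hu0 ω hω
    | succ k => exact (hproj ω hω k).1
  -- uniform bounds
  obtain ⟨M₁, hM₁⟩ := (hUcp.prod hΩcp).bddAbove_image hℓc.continuousOn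
  have hM₁' : ∀ ω ∈ Ω, ∀ x ∈ U, ℓ x ω ≤ M₁ := fun ω hω x hx =>
    hM₁ ⟨(x, ω), ⟨hx, hω⟩, rfl⟩
  have hHc : Continuous fun p : (EuclideanSpace ℝ (Fin n)) × (EuclideanSpace ℝ (Fin n)) => hIP Hub (p.1 - p.2) (p.1 - p.2) := by
    have h1 : Continuous (Matrix.toEuclideanLin Hub) := LinearMap.continuous_of_finiteDimensional _
    have h2 : Continuous fun p : (EuclideanSpace ℝ (Fin n)) × (EuclideanSpace ℝ (Fin n)) => p.1 - p.2 := continuous_fst.sub continuous_snd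
    exact h2.inner (h1.comp h2)
  obtain ⟨R₀, hR₀⟩ := (hUcp.prod hUcp).bddAbove_image hHc.continuousOn
  have hR₀' : ∀ x ∈ U, ∀ y ∈ U, hIP Hub (x - y) (x - y) ≤ R₀ := fun x hx y hy =>
    hR₀ ⟨(x, y), ⟨hx, hy⟩, rfl⟩
  set G := √(2 * L * (M₁ - M₀) / lam) with hG
  set R := √R₀ with hR
  obtain ⟨δ, hδ, hrate⟩ := unif_rate (F := (EuclideanSpace ℝ (Fin n))) hα hμ hs0 (Real.sqrt_nonneg _ : 0 ≤ G)
    (Real.sqrt_nonneg _ : 0 ≤ R) hΛ hsΛ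
  -- the analysis for a fixed parameter
  have key : ∀ ω ∈ Ω, (∀ k, ‖u k ω - D (u k ω) ω‖ ≤ δ k / √lam) ∧
      Tendsto (fun k => ℓ (u k ω) ω) atTop (𝓝 (φ ω)) := by
    intro ω hω
    obtain ⟨B, hB⟩ := aux_factor (HM ω) (hHM ω hω)
    have hBn2 : ∀ v, ‖B v‖ ^ 2 = hIP (HM ω) v v := fun v => by
      rw [← hB, real_inner_self_eq_norm_sq]
    have hBn : ∀ v, hNorm (HM ω) v = ‖B v‖ := fun v => by
      rw [hNorm, ← hBn2, Real.sqrt_sq (norm_nonneg _)]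
    have hBlow : ∀ v, lam * ‖v‖ ^ 2 ≤ ‖B v‖ ^ 2 := fun v => by
      rw [hBn2]
      exact (aux_lambda Hlb hlb.1 v).trans (hHMlb ω hω v)
    have hBlow' : ∀ v, ‖v‖ ≤ ‖B v‖ / √lam := fun v => by
      rw [le_div_iff₀ (Real.sqrt_pos.2 hlam0)]
      refine le_of_sq_le_sq ?_ (norm_nonneg _)
      rw [mul_pow, Real.sq_sqrt hlam0.le]
      linarith [hBlow v]
    have hBinj : Function.Injective B := by
      intro a b hab
      have h1 := hBlow' (a - b)
      rw [map_sub, hab, sub_self, norm_zero, zero_div] at h1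
      exact sub_eq_zero.1 (norm_le_zero_iff.1 h1)
    have hBR : ∀ x ∈ U, ∀ y ∈ U, ‖B x - B y‖ ≤ R := fun x hx y hy => by
      rw [← map_sub]
      refine Real.le_sqrt_of_sq_le ?_
      rw [hBn2]
      exact (hHMub ω hω _).trans (hR₀' x hx y hy)
    set Hi : (EuclideanSpace ℝ (Fin n)) → (EuclideanSpace ℝ (Fin n)) := fun v => Matrix.toEuclideanLin (HM ω)⁻¹ v with hHi
    have hHisub : ∀ a b, Hi a - Hi b = Hi (a - b) := fun a b => (map_sub _ a b).symm
    have hBi : ∀ a v, ⟪B a, B (Hi v)⟫ = ⟪a, v⟫ := fun a v => by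
      rw [hB, hIP, hHi, aux_inv _ (hHM ω hω)]
    have hBHi : ∀ v, ‖B (Hi v)‖ ^ 2 ≤ ‖v‖ ^ 2 / lam := fun v => by
      have h1 : ‖B (Hi v)‖ ^ 2 = ⟪Hi v, v⟫ := by
        rw [← real_inner_self_eq_norm_sq, hBi]
      have h2 := hBlow (Hi v)
      have h3 := real_inner_le_norm (Hi v) v
      rw [le_div_iff₀ hlam0]
      rw [h1] at h2 ⊢
      have h4 : lam * ‖Hi v‖ ≤ ‖v‖ := by
        by_contra hc
        push Not at hc
        have : 0 < ‖Hi v‖ := by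
          rcases (norm_nonneg (Hi v)).eq_or_lt with h0 | h0
          · rw [← h0, mul_zero] at hc
            exact absurd hc (not_lt.2 (norm_nonneg v))
          · exact h0
        nlinarith
      nlinarith [norm_nonneg v, norm_nonneg (Hi v)]
    set f : (EuclideanSpace ℝ (Fin n)) → ℝ := fun x => ℓ x ω with hf
    have hfc : Continuous f := hℓc.comp (continuous_id.prodMk continuous_const)
    set x : ℕ → (EuclideanSpace ℝ (Fin n)) := fun k => B (u k ω) with hx
    set y : ℕ → (EuclideanSpace ℝ (Fin n)) := fun k => B (D (u k ω) ω) with hy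
    set g : ℕ → (EuclideanSpace ℝ (Fin n)) := fun k => B (Hi (gradient f (u k ω))) with hg
    have hz : ∀ k : ℕ, B (μ • vu (k + 1) ω + (1 - μ) • vl (k + 1) ω) =
        x k + ((1 - μ) * α) • (y k - x k) - (μ * (s / ((k : ℝ) + 1))) • g k := by
      intro k
      rw [hvu ω hω, hvl ω hω, hT]
      simp only [map_add, map_smul, map_sub, hx, hy, hg, hHi]
      module
    have hgG : ∀ k, ‖g k‖ ≤ G := fun k => by
      refine Real.le_sqrt_of_sq_le ((hBHi _).trans ?_)
      have h1 := aux_gradbound (hdiff ω hω) hL (hLip ω hω) (hbdd ω hω) (u k ω)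
      have h2 := hM₁' ω hω _ (huU ω hω k)
      gcongr
      refine h1.trans ?_
      gcongr
    have hVco : Convex ℝ (B '' U) := hUco.linear_image B.toLinearMap
    have hpr : ∀ k : ℕ, ∀ w ∈ B '' U, ‖x (k + 1) - (x k + ((1 - μ) * α) • (y k - x k)
          - (μ * (s / ((k : ℝ) + 1))) • g k)‖ ≤
        ‖w - (x k + ((1 - μ) * α) • (y k - x k) - (μ * (s / ((k : ℝ) + 1))) • g k)‖ := by
      rintro k _ ⟨w, hw, rfl⟩
      have h1 := (hproj ω hω k).2 w hw
      rw [hBn, hBn, map_sub, map_sub, hz] at h1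
      exact h1
    have hyn : ∀ a b, ‖B (D a ω) - B (D b ω)‖ ≤ ‖B a - B b‖ := fun a b => by
      have h1 := hD ω hω a b
      rwa [hBn, hBn, map_sub, map_sub] at h1
    have hyp : ∀ p, D p ω = p → ∀ k, ‖y k - B p‖ ≤ ‖x k - B p‖ := fun p hp k => by
      have h1 := hyn (u k ω) p
      rwa [hp] at h1
    have hxV : ∀ k, x k ∈ B '' U := fun k => ⟨_, huU ω hω k, rfl⟩
    obtain ⟨p₁, hp₁, hp₁U⟩ := hFix ω hω
    have hp₁' : D p₁ ω = p₁ := (hfix _ _).1 hp₁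
    have hr := hrate (B '' U) x y g (B p₁) hVco ⟨p₁, hp₁U, rfl⟩ hxV hpr
      (fun j k => hyn _ _) (hyp p₁ hp₁')
      (by
        intro j k
        have h1 := aux_coco (hdiff ω hω) (hconv ω hω) hL (hLip ω hω) (u j ω) (u k ω)
        have e1 : g j - g k = B (Hi (gradient f (u j ω) - gradient f (u k ω))) := by
          simp only [hg]
          rw [← hHisub]
          exact (map_sub B _ _).symm
        have e2 : x j - x k = B (u j ω - u k ω) := by
          simp only [hx]
          exact (map_sub B _ _).symm
        rw [e1, e2, hBi]
        refine (hBHi _).trans ?_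
        rw [div_mul_eq_mul_div]
        gcongr)
      hgG (fun k => hBR _ (huU ω hω k) _ hp₁U)
    have hres : ∀ k, ‖u k ω - D (u k ω) ω‖ ≤ δ k / √lam := fun k => by
      refine (hBlow' _).trans ?_
      rw [map_sub]
      gcongr
      exact (hr k).2
    refine ⟨hres, ?_⟩
    have hres0 : Tendsto (fun k => u k ω - D (u k ω) ω) atTop (𝓝 0) := by
      refine squeeze_zero_norm hres ?_
      simpa using hδ.div_const (√lam)
    set θ := (1 - μ) * α with hθ
    have hθ0 : 0 < θ := mul_pos (by linarith) hα0
    have hθ1 : θ < 1 := by nlinarith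
    rw [hφ]
    have hh0 : Tendsto (fun k : ℕ => 1 / ((k : ℝ) + 1)) atTop (𝓝 0) :=
      tendsto_one_div_add_atTop_nhds_zero_nat
    refine pointwise B hBinj hUcp hfc Set.inter_subset_right ?_ ⟨p₁, hp₁, hp₁U⟩ (huU ω hω) ?_
      (t := fun k => μ * s * (1 / ((k : ℝ) + 1)))
      (η := fun k => 2 * G * θ * δ k + μ * s * (1 / ((k : ℝ) + 1)) * G ^ 2) (d := δ)
      (fun k => by positivity) ?_ ?_ hδ ?_ (fun k => (hr k).1)
    · refine IsSeqClosed.isClosed fun a b ha hab => ?_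
      have hbU : b ∈ U := hUcp.isClosed.mem_of_tendsto hab (Eventually.of_forall fun j => (ha j).2)
      refine ⟨(hfix _ _).2 ?_, hbU⟩
      refine (hDgraph a (fun _ => ω) b ω b (fun j => (ha j).2) (fun _ => hω) hab
        tendsto_const_nhds ?_).symm
      refine hab.congr fun j => ?_
      exact ((hfix _ _).1 (ha j).1).symm
    · intro ψ hψ ub hub
      have hbU : ub ∈ U := hUcp.isClosed.mem_of_tendsto hub
        (Eventually.of_forall fun j => huU ω hω _)
      refine ⟨(hfix _ _).2 ?_, hbU⟩
      refine (hDgraph (fun j => u (ψ j) ω) (fun _ => ω) ub ω ub (fun j => huU ω hω _)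
        (fun _ => hω) hub tendsto_const_nhds ?_).symm
      have := hub.sub (hres0.comp hψ.tendsto_atTop)
      simpa using this
    · simp_rw [← Finset.mul_sum]
      exact Real.tendsto_sum_range_one_div_nat_succ_atTop.const_mul_atTop (mul_pos hμ0 hs0)
    · have := (hδ.const_mul (2 * G * θ)).add ((hh0.const_mul (μ * s)).mul_const (G ^ 2))
      simpa only [mul_zero, zero_mul, add_zero] using this
    · rintro p ⟨hp, hpU⟩ k
      have hp' : D p ω = p := (hfix _ _).1 hp
      have a1 := aux_proj_pyth hVco (hxV (k + 1)) (hpr k) ⟨p, hpU, rfl⟩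
      have a2 := aux_step (t := μ * (s / ((k : ℝ) + 1))) (g := g k) hθ0 (hyp p hp' k)
      have a3 : f (u k ω) - f p ≤ ⟪g k, x k - B p⟫ := by
        have b1 := aux_convex (hdiff ω hω) (hconv ω hω) (u k ω) p
        simp only [hg, hx]
        rw [← map_sub, real_inner_comm, hBi, real_inner_comm]
        rw [← neg_sub, inner_neg_right] at b1
        simp only [hf]
        linarith
      have a4 : ⟪g k, x k + θ • (y k - x k) - B p⟫ =
          ⟪g k, x k - B p⟫ - θ * ⟪g k, x k - y k⟫ := by
        rw [← real_inner_smul_right, ← inner_sub_right]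
        congr 1
        module
      have a5 : ⟪g k, x k - y k⟫ ≤ G * δ k :=
        (real_inner_le_norm _ _).trans
          (mul_le_mul (hgG k) (hr k).2 (norm_nonneg _) (Real.sqrt_nonneg _))
      have a6 : f (u k ω) - f p - θ * (G * δ k) ≤ ⟪g k, x k + θ • (y k - x k) - B p⟫ := by
        rw [a4]
        have := mul_le_mul_of_nonneg_left a5 hθ0.le
        linarith
      have e : μ * (s / ((k : ℝ) + 1)) = μ * s * (1 / ((k : ℝ) + 1)) := by ring
      rw [e] at a1 a2
      set τ := μ * s * (1 / ((k : ℝ) + 1)) with hτ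
      have hτ0 : 0 ≤ τ := by positivity
      have a7 := mul_le_mul_of_nonneg_left a6 hτ0
      have a8 : τ ^ 2 * ‖g k‖ ^ 2 ≤ τ ^ 2 * G ^ 2 := by
        gcongr
        exact hgG k
      have a9 : 0 ≤ θ * (1 - θ) * ‖x k - y k‖ ^ 2 :=
        mul_nonneg (mul_nonneg hθ0.le (by linarith)) (sq_nonneg _)
      have a10 := sq_nonneg ‖x (k + 1) - (x k + θ • (y k - x k) - τ • g k)‖
      have goal' : ‖x (k + 1) - B p‖ ^ 2 ≤ ‖x k - B p‖ ^ 2 -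
          τ * (2 * (f (u k ω) - f p) - (2 * G * θ * δ k + τ * G ^ 2)) := by
        linarith
      exact goal'
  have hδl : Tendsto (fun k => δ k / √lam) atTop (𝓝 0) := by
    simpa using hδ.div_const (√lam)
  set a : ℕ → ℝ := fun K => ℓ (u K (ωK K)) (ωK K) with ha
  have hφbdd : ∀ ω ∈ Ω, ∀ p ∈ U, D p ω = p → φ ω ≤ ℓ p ω := by
    intro ω hω p hp hDp
    rw [hφ]
    refine csInf_le ⟨M₀, ?_⟩ ⟨p, ⟨(hfix _ _).2 hDp, hp⟩, rfl⟩
    rintro _ ⟨q, -, rfl⟩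
    exact hbdd ω hω q
  have hLP : ∀ (ub : (EuclideanSpace ℝ (Fin n))) (ωb : EuclideanSpace ℝ (Fin m)) (ψ : ℕ → ℕ), Tendsto ψ atTop atTop →
      Tendsto (fun j => u (ψ j) (ωK (ψ j))) atTop (𝓝 ub) →
      Tendsto (fun j => ωK (ψ j)) atTop (𝓝 ωb) →
      D ub ωb = ub ∧ ℓ ub ωb = sInf (φ '' Ω) ∧ φ ωb = sInf (φ '' Ω) ∧
      Tendsto (fun j => a (ψ j)) atTop (𝓝 (sInf (φ '' Ω))) := by
    intro ub ωb ψ hψ h1 h2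
    have hubU : ub ∈ U := hUcp.isClosed.mem_of_tendsto h1
      (Eventually.of_forall fun j => huU _ (hωKΩ _) _)
    have hωb : ωb ∈ Ω := hΩcp.isClosed.mem_of_tendsto h2 (Eventually.of_forall fun j => hωKΩ _)
    have hres0 : Tendsto (fun j => u (ψ j) (ωK (ψ j)) - D (u (ψ j) (ωK (ψ j))) (ωK (ψ j)))
        atTop (𝓝 0) :=
      squeeze_zero_norm (fun j => (key _ (hωKΩ (ψ j))).1 (ψ j)) (hδl.comp hψ)
    have hDub : D ub ωb = ub := by
      refine (hDgraph (fun j => u (ψ j) (ωK (ψ j))) (fun j => ωK (ψ j)) ub ωb ub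
        (fun j => huU _ (hωKΩ _) _) (fun j => hωKΩ _) h1 h2 ?_).symm
      simpa using h1.sub hres0
    have hal : Tendsto (fun j => a (ψ j)) atTop (𝓝 (ℓ ub ωb)) :=
      (hℓc.tendsto (ub, ωb)).comp (h1.prodMk_nhds h2)
    have hle1 : φ ωb ≤ ℓ ub ωb := hφbdd ωb hωb ub hubU hDub
    have hle2 : ∀ ω ∈ Ω, ℓ ub ωb ≤ φ ω := fun ω hω =>
      le_of_tendsto_of_tendsto' hal ((key ω hω).2.comp hψ) fun j => hωKmin _ ω hω
    have hinf : φ ωb = sInf (φ '' Ω) := by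
      symm
      refine IsLeast.csInf_eq ⟨⟨ωb, hωb, rfl⟩, ?_⟩
      rintro _ ⟨ω, hω, rfl⟩
      exact hle1.trans (hle2 ω hω)
    have heq : ℓ ub ωb = sInf (φ '' Ω) := by
      rw [← hinf]
      exact le_antisymm (hle2 ωb hωb) hle1
    exact ⟨hDub, heq, hinf, heq ▸ hal⟩
  refine ⟨?_, ?_⟩
  · rintro ub ωb ⟨ψ, hψ, hlim⟩
    have h := hLP ub ωb ψ hψ.tendsto_atTop
      ((continuous_fst.tendsto _).comp hlim) ((continuous_snd.tendsto _).comp hlim)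
    exact ⟨h.2.2.1, (hfix _ _).2 h.1⟩
  · have hinfa : ∀ K, sInf ((fun ω => ℓ (u K ω) ω) '' Ω) = a K := by
      intro K
      refine IsLeast.csInf_eq ⟨⟨ωK K, hωKΩ K, rfl⟩, ?_⟩
      rintro _ ⟨ω, hω, rfl⟩
      exact hωKmin K ω hω
    simp_rw [hinfa]
    refine tendsto_of_subseq_tendsto fun ns hns => ?_
    obtain ⟨⟨ub, ωb⟩, -, χ, hχ, hlim⟩ := (hUcp.prod hΩcp).tendsto_subseq
      (x := fun j => (u (ns j) (ωK (ns j)), ωK (ns j)))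
      (fun j => ⟨huU _ (hωKΩ _) _, hωKΩ _⟩)
    refine ⟨χ, ?_⟩
    exact (hLP ub ωb (ns ∘ χ) (hns.comp hχ.tendsto_atTop)
      ((continuous_fst.tendsto _).comp hlim) ((continuous_snd.tendsto _).comp hlim)).2.2.2
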